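/- arXiv:math/0407203 — 2 statements merged into one kernel-verified Lean document; each statement's English description precedes it below -/
import Mathlib

section
/- The class of groups Γ for which the group ring Z[Γ] satisfies the right Ore condition is closed under extensions: if N is normal in G, and Z[N] and Z[G/N] are right Ore domains with Z[G] a domain, then Z[G] is a right Ore domain. -/
lemma ore_system {R : Type*} [Ring R] [Nontrivial R]
    (hdom : ∀ a b : R, a * b = 0 → a = 0 ∨ b = 0)
    (hore : ∀ a b : R, a ≠ 0 → b ≠ 0 → ∃ x y : R, x ≠ 0 ∧ y ≠ 0 ∧ a * x = b * y)
    {κ ι : Type*} [DecidableEq κ] [DecidableEq ι] (I : Finset κ) :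
    ∀ (J : Finset ι) (A : κ → ι → R), I.card < J.card →
      ∃ x : ι → R, (∃ j ∈ J, x j ≠ 0) ∧ ∀ i ∈ I, ∑ j ∈ J, A i j * x j = 0 := by
  induction I using Finset.induction with
  | empty =>
    intro J A h
    obtain ⟨j, hj⟩ := Finset.card_pos.1 (lt_of_le_of_lt (Nat.zero_le _) h)
    exact ⟨fun _ => 1, ⟨j, hj, one_ne_zero⟩, by simp⟩
  | insert i0 I hi IH =>
    intro J A h
    rw [Finset.card_insert_of_notMem hi] at h
    by_cases h0 : ∀ j ∈ J, A i0 j = 0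
    · obtain ⟨x, hx, hs⟩ := IH J A (by omega)
      refine ⟨x, hx, ?_⟩
      intro i hi'
      rcases Finset.mem_insert.1 hi' with rfl | hi'
      · exact Finset.sum_eq_zero fun j hj => by rw [h0 j hj, zero_mul]
      · exact hs i hi'
    · push Not at h0
      obtain ⟨p, hp, hap⟩ := h0
      have : ∀ j, ∃ u v : R, u ≠ 0 ∧ A i0 j * u = A i0 p * v := by
        intro j
        by_cases hj : A i0 j = 0
        · exact ⟨1, 0, one_ne_zero, by simp [hj]⟩
        · obtain ⟨x, y, hx, _, hxy⟩ := hore _ _ hj hap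
          exact ⟨x, y, hx, hxy⟩
      choose u v hu huv using this
      have hc := Finset.card_erase_of_mem hp
      obtain ⟨z, ⟨j0, hj0, hz⟩, hs⟩ := IH (J.erase p)
        (fun i j => A i j * u j - A i p * v j) (by omega)
      have key : ∀ i, ∑ j ∈ J, A i j * (if j = p then -∑ j ∈ J.erase p, v j * z j else u j * z j)
          = ∑ j ∈ J.erase p, (A i j * u j - A i p * v j) * z j := by
        intro i
        rw [← Finset.add_sum_erase _ _ hp, if_pos rfl, mul_neg, Finset.mul_sum,
          ← Finset.sum_neg_distrib, ← Finset.sum_add_distrib]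
        refine Finset.sum_congr rfl fun j hj => ?_
        rw [if_neg (Finset.ne_of_mem_erase hj)]
        noncomm_ring
      refine ⟨fun j => if j = p then -∑ j ∈ J.erase p, v j * z j else u j * z j,
        ⟨j0, Finset.mem_of_mem_erase hj0, ?_⟩, ?_⟩
      · simp only [if_neg (Finset.ne_of_mem_erase hj0)]
        intro h
        rcases hdom _ _ h with h | h
        · exact hu _ h
        · exact hz h
      · intro i hi'
        rw [key]
        rcases Finset.mem_insert.1 hi' with rfl | hi'
        · exact Finset.sum_eq_zero fun j hj => by rw [huv, sub_self, zero_mul]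
        · exact hs i hi'

/-- A combinatorial family. -/
lemma exists_family {T : Type} [Fintype T] [DecidableEq T] (K : ℕ) (hK : Fintype.card T ≤ 2 ^ K) :
    ∃ (Y : Type) (_ : Fintype Y) (_ : DecidableEq Y) (_ : Nonempty Y) (X : T → Finset Y),
      ∀ (j : T) (I : Finset T), j ∈ I →
        (Fintype.card Y : ℝ) / (8 * (K + 1) * I.card) ≤
          ((X j).filter (fun y => ∀ i ∈ I, i ≠ j → y ∉ X i)).card := by
  classical
  refine ⟨Fin (K+1) × (T → Fin (2 ^ (K+1))), inferInstance, inferInstance, inferInstance,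
    fun j => Finset.univ.filter (fun y => (y.2 j).val < 2 ^ (K - y.1.val)), ?_⟩
  intro j I hj
  have hIpos : 0 < I.card := Finset.card_pos.2 ⟨j, hj⟩
  have hIK : I.card ≤ 2 ^ K := (Finset.card_le_univ I).trans hK
  set l := Nat.clog 2 I.card with hl
  have hlK : l ≤ K := Nat.clog_le_of_le_pow hIK
  have h1 : I.card ≤ 2 ^ l := Nat.le_pow_clog (by norm_num) _
  have h2 : 2 ^ l ≤ 2 * I.card := by
    rcases Nat.lt_or_ge 1 I.card with h | h
    · have hpred := Nat.pow_pred_clog_lt_self (b := 2) (by norm_num) h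
      have hl0 : 0 < l := Nat.clog_pos (by norm_num) h
      have : 2 ^ l = 2 * 2 ^ (l-1) := by rw [← pow_succ']; congr 1; omega
      rw [Nat.pred_eq_sub_one, ← hl] at hpred
      omega
    · have : I.card = 1 := by omega
      rw [hl, this]; simp
  -- sets at level l
  let M := 2 ^ (K+1)
  let b := 2 ^ (K - l)
  have hbM : b ≤ M := Nat.pow_le_pow_right (by norm_num) (by omega)
  let lo : Finset (Fin M) := Finset.univ.filter (fun a => a.val < b)
  have hlo : lo.card = b := by
    simp only [lo]
    rw [Fin.card_filter_val_lt]; omega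
  have hloc : loᶜ.card = M - b := by rw [Finset.card_compl, hlo, Fintype.card_fin]
  let B : T → Finset (Fin M) := fun i => if i = j then lo else if i ∈ I then loᶜ else Finset.univ
  have hcard : (Fintype.piFinset B).card = b * (M - b) ^ (I.card - 1) * M ^ (Fintype.card T - I.card) := by
    rw [Fintype.card_piFinset, ← Finset.prod_mul_prod_compl I, ← Finset.mul_prod_erase _ _ hj]
    congr 1
    · congr 1
      · simp [B, hlo]
      · rw [Finset.prod_congr rfl (g := fun _ => M - b), Finset.prod_const, Finset.card_erase_of_mem hj]
        intro i hi
        simp [B, Finset.ne_of_mem_erase hi, Finset.mem_of_mem_erase hi, hloc]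
    · rw [Finset.prod_congr rfl (g := fun _ => M), Finset.prod_const, Finset.card_compl]
      intro i hi
      rw [Finset.mem_compl] at hi
      have : i ≠ j := fun h => hi (h ▸ hj)
      simp [B, hi, this]
  have hle : (Fintype.piFinset B).card ≤ _ := Finset.card_le_card_of_injOn
    (t := ((Finset.univ.filter (fun y : Fin (K+1) × (T → Fin (2 ^ (K+1))) => (y.2 j).val < 2 ^ (K - y.1.val))).filter
      (fun y => ∀ i ∈ I, i ≠ j → y ∉ Finset.univ.filter (fun y : Fin (K+1) × (T → Fin (2 ^ (K+1))) => (y.2 i).val < 2 ^ (K - y.1.val)))))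
    (fun f => ((⟨l, by omega⟩ : Fin (K+1)), f)) (by
      intro f hf
      rw [Finset.mem_coe, Fintype.mem_piFinset] at hf
      simp only [Finset.coe_filter, Finset.mem_filter, Finset.mem_univ, true_and, Set.mem_ofPred_eq]
      refine ⟨?_, ?_⟩
      · have := hf j
        simpa [B, lo] using this
      · intro i hi hij
        have := hf i
        simpa [B, lo, hij, hi] using this) (by
      intro f _ g _ h
      simpa using h)
  refine le_trans ?_ (Nat.cast_le.2 hle)
  rw [hcard]
  have hMr : (M : ℝ) = 2 * 2 ^ l * b := by
    simp only [M, b]; push_cast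
    rw [mul_assoc, ← pow_add, ← pow_succ']; congr 1; omega
  have hb0 : (0 : ℝ) < b := by simp only [b]; positivity
  have hM0 : (0 : ℝ) < M := by simp only [M]; positivity
  have hIr : (0 : ℝ) < I.card := by exact_mod_cast hIpos
  have h1r : (I.card : ℝ) ≤ 2 ^ l := by exact_mod_cast h1
  have h2r : (2 : ℝ) ^ l ≤ 2 * I.card := by exact_mod_cast h2
  have hbern : (1 : ℝ) / 2 * M ^ (I.card - 1) ≤ ((M - b : ℕ) : ℝ) ^ (I.card - 1) := by
    have e : ((M - b : ℕ) : ℝ) = M * (1 + (-(b / M))) := by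
      rw [Nat.cast_sub hbM]; field_simp; ring
    have hq : (b : ℝ) / M = 1 / (2 * 2 ^ l) := by rw [hMr]; field_simp
    have hq1 : (1 : ℝ) / (2 * 2 ^ l) ≤ 1 := by
      rw [div_le_one (by positivity)]; linarith [one_le_pow₀ (n := l) (one_le_two (α := ℝ))]
    have := one_add_mul_le_pow (a := -((b : ℝ) / M)) (by rw [hq]; linarith) (I.card - 1)
    rw [e, mul_pow, mul_comm]
    gcongr
    refine le_trans ?_ this
    rw [hq, Nat.cast_sub hIpos]
    have : ((I.card : ℝ) - 1) * (1 / (2 * 2 ^ l)) ≤ 1 / 2 := by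
      rw [mul_one_div, div_le_div_iff₀ (by positivity) (by norm_num)]
      linarith
    push_cast
    linarith
  push_cast
  have hcY : (Fintype.card (Fin (K+1) × (T → Fin (2 ^ (K+1)))) : ℝ) = (K + 1) * (M * M ^ (I.card - 1) * M ^ (Fintype.card T - I.card)) := by
    rw [← pow_succ', ← pow_add]
    have : I.card - 1 + 1 + (Fintype.card T - I.card) = Fintype.card T := by
      have := Finset.card_le_univ I
      omega
    rw [this]
    simp [M]
  rw [hcY]
  have hb : (M : ℝ) / (4 * I.card) ≤ b := by
    rw [div_le_iff₀ (by positivity), hMr]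
    nlinarith
  calc _ = (M : ℝ) / (4 * I.card) * (1 / 2 * M ^ (I.card - 1)) * M ^ (Fintype.card T - I.card) := by
        field_simp; ring
    _ ≤ _ := by gcongr

open scoped Pointwise in
lemma exists_good_point {Q : Type} [Group Q] [DecidableEq Q] (T F : Finset Q) (C : ℝ)
    (hF : F.Nonempty) (hC : C * F.card ≤ (T * F).card) :
    ∃ g ∈ F, C ≤ ∑ j : T, (1 : ℝ) /
      ((Finset.univ.filter (fun i : T => (i : Q)⁻¹ * ((j : Q) * g) ∈ F)).card : ℝ) := by
  let φ : Q → ℝ := fun h => (1 : ℝ) / ((Finset.univ.filter (fun i : T => (i : Q)⁻¹ * h ∈ F)).card : ℝ)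
  have e1 : ∑ h ∈ T * F, ∑ j : T, (if (j : Q)⁻¹ * h ∈ F then φ h else 0) = ((T * F).card : ℝ) := by
    rw [Finset.sum_congr rfl (g := fun _ => (1 : ℝ))]
    · simp
    · intro h hh
      rw [← Finset.sum_filter, Finset.sum_const, nsmul_eq_mul]
      simp only [φ]
      rw [mul_one_div, div_self]
      obtain ⟨t, ht, f, hf, rfl⟩ := Finset.mem_mul.1 hh
      have : 0 < (Finset.univ.filter (fun i : T => (i : Q)⁻¹ * (t * f) ∈ F)).card :=
        Finset.card_pos.2 ⟨⟨t, ht⟩, by simpa using hf⟩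
      exact_mod_cast this.ne'
  have e2 : ∑ g ∈ F, ∑ j : T, φ ((j : Q) * g) = ((T * F).card : ℝ) := by
    rw [← e1, Finset.sum_comm, Finset.sum_comm (s := T * F)]
    refine Finset.sum_congr rfl fun j _ => ?_
    rw [← Finset.sum_filter]
    refine Finset.sum_nbij' (fun g => (j : Q) * g) (fun h => (j : Q)⁻¹ * h) ?_ ?_ ?_ ?_ ?_
    · intro g hg
      simp only [Finset.mem_filter, inv_mul_cancel_left]
      exact ⟨Finset.mul_mem_mul j.2 hg, hg⟩
    · intro h hh
      exact (Finset.mem_filter.1 hh).2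
    · intro g _; simp
    · intro g _; simp
    · intro g _; rfl
  refine Finset.exists_le_of_sum_le hF (f := fun _ => C) ?_
  rw [Finset.sum_const, nsmul_eq_mul, mul_comm]
  exact hC.trans e2.ge

open scoped Pointwise in
lemma expansion_bound {Q : Type} [Group Q] [DecidableEq Q]
    (hdom : ∀ a b : MonoidAlgebra ℤ Q, a * b = 0 → a = 0 ∨ b = 0)
    (hore : ∀ a b : MonoidAlgebra ℤ Q, a ≠ 0 → b ≠ 0 →
      ∃ x y : MonoidAlgebra ℤ Q, x ≠ 0 ∧ y ≠ 0 ∧ a * x = b * y)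
    (T : Finset Q) (K : ℕ) (hK : T.card ≤ 2 ^ K) (C : ℝ) (hC : 8 * (K + 1) < C) :
    ∃ F : Finset Q, F.Nonempty ∧ ((T * F).card : ℝ) < C * F.card := by
  classical
  by_contra hcon
  push Not at hcon
  obtain ⟨Y, _, _, _, X, hX⟩ := exists_family (T := T) K (by simpa using hK)
  let t : T × Y → ℤ := fun p => ((Fintype.equivFin (T × Y) p : ℕ) : ℤ)
  have ht : Function.Injective t := fun p q h => by
    simpa [t, Fin.val_inj] using h
  let α : T → Y → ℕ → ℤ := fun j y w => if y ∈ X j then t (j, y) ^ w else 0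
  obtain ⟨x, ⟨w0, hw0, hx0⟩, hsol⟩ := ore_system hdom hore (Finset.univ : Finset Y)
    (Finset.range (Fintype.card Y + 1))
    (fun y w => ∑ j : T, MonoidAlgebra.single (j : Q) (α j y w)) (by simp)
  let F : Finset Q := (Finset.range (Fintype.card Y + 1)).biUnion fun w => (x w).coeff.support
  have hFne : F.Nonempty := by
    have : (x w0).coeff ≠ 0 := by simpa using hx0
    obtain ⟨g, hg⟩ := Finsupp.support_nonempty_iff.2 this
    exact ⟨g, Finset.mem_biUnion.2 ⟨w0, hw0, hg⟩⟩
  have hFz : ∀ w ∈ Finset.range (Fintype.card Y + 1), ∀ h, h ∉ F → (x w).coeff h = 0 := by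
    intro w hw h hh
    by_contra hne
    exact hh (Finset.mem_biUnion.2 ⟨w, hw, Finsupp.mem_support_iff.2 hne⟩)
  have heq : ∀ y h, ∑ j : T, ∑ w ∈ Finset.range (Fintype.card Y + 1),
      α j y w * (x w).coeff ((j : Q)⁻¹ * h) = 0 := by
    intro y h
    have := congrArg (fun c => c.coeff h) (hsol y (Finset.mem_univ _))
    simp only [Finset.sum_mul, MonoidAlgebra.coeff_sum, Finsupp.finsetSum_apply,
      MonoidAlgebra.coeff_single_mul_apply, MonoidAlgebra.coeff_zero, Finsupp.zero_apply] at this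
    rw [Finset.sum_comm]
    exact this
  obtain ⟨g, hg, hgC⟩ := exists_good_point T F C hFne (hcon F hFne)
  let I : T → Finset T := fun j => Finset.univ.filter (fun i : T => (i : Q)⁻¹ * ((j : Q) * g) ∈ F)
  have hjI : ∀ j, j ∈ I j := fun j => by simpa [I] using hg
  let P : T → Finset Y := fun j => (X j).filter (fun y => ∀ i ∈ I j, i ≠ j → y ∉ X i)
  let p : Polynomial ℤ := ∑ w ∈ Finset.range (Fintype.card Y + 1),
    Polynomial.C ((x w).coeff g) * Polynomial.X ^ w
  have hroot : ∀ j, ∀ y ∈ P j, p.eval (t (j, y)) = 0 := by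
    intro j y hy
    obtain ⟨hyj, hyI⟩ := Finset.mem_filter.1 hy
    have := heq y ((j : Q) * g)
    rw [Finset.sum_eq_single j] at this
    · rw [← this]
      simp only [p, Polynomial.eval_finsetSum, Polynomial.eval_mul, Polynomial.eval_C,
        Polynomial.eval_pow, Polynomial.eval_X]
      refine Finset.sum_congr rfl fun w _ => ?_
      simp [α, hyj, mul_comm]
    · intro i _ hij
      refine Finset.sum_eq_zero fun w hw => ?_
      by_cases hi : i ∈ I j
      · simp [α, hyI i hi hij]
      · rw [hFz w hw, mul_zero]
        simpa [I] using hi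
    · simp
  have hpdeg : p.natDegree ≤ Fintype.card Y := by
    refine Polynomial.natDegree_sum_le_of_forall_le _ _ fun w hw => ?_
    refine (Polynomial.natDegree_C_mul_X_pow_le _ _).trans ?_
    have := Finset.mem_range.1 hw
    omega
  have hcount : Fintype.card Y < Fintype.card (Σ j : T, P j) := by
    rw [Fintype.card_sigma]
    have hYpos : (0 : ℝ) < Fintype.card Y := by exact_mod_cast Fintype.card_pos
    have hK1 : (0 : ℝ) < 8 * (K + 1) := by positivity
    have : (Fintype.card Y : ℝ) < ∑ j : T, ((P j).card : ℝ) := by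
      calc (Fintype.card Y : ℝ) < (Fintype.card Y : ℝ) / (8 * (K + 1)) * C := by
            rw [div_mul_eq_mul_div, lt_div_iff₀ hK1]
            gcongr
        _ ≤ (Fintype.card Y : ℝ) / (8 * (K + 1)) * ∑ j : T, (1 : ℝ) / ((I j).card : ℝ) := by
            gcongr
        _ = ∑ j : T, (Fintype.card Y : ℝ) / (8 * (K + 1) * (I j).card) := by
            rw [Finset.mul_sum]
            refine Finset.sum_congr rfl fun j _ => ?_
            rw [div_mul_div_comm, mul_one]
        _ ≤ _ := Finset.sum_le_sum fun j _ => hX j (I j) (hjI j)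
    simp only [Fintype.card_coe]
    exact_mod_cast this
  have hp0 : p = 0 := by
    refine Polynomial.eq_zero_of_natDegree_lt_card_of_eval_eq_zero p
      (f := fun s : (Σ j : T, P j) => t (s.1, s.2.1)) ?_ ?_ (hpdeg.trans_lt hcount)
    · rintro ⟨j, y, hy⟩ ⟨j', y', hy'⟩ h
      have := ht h
      simp only [Prod.mk.injEq] at this
      obtain ⟨rfl, rfl⟩ := this
      rfl
    · rintro ⟨j, y, hy⟩
      exact hroot j y hy
  obtain ⟨w, hw, hgw⟩ := Finset.mem_biUnion.1 hg
  have hc : p.coeff w = (x w).coeff g := by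
    simp only [p, Polynomial.finsetSum_coeff, Polynomial.coeff_C_mul_X_pow]
    rw [Finset.sum_ite_eq]
    simp only [hw, if_true]
  rw [hp0, Polynomial.coeff_zero] at hc
  exact Finsupp.mem_support_iff.1 hgw hc.symm

open scoped Pointwise in
lemma ore_folner {Q : Type} [Group Q] [DecidableEq Q]
    (hdom : ∀ a b : MonoidAlgebra ℤ Q, a * b = 0 → a = 0 ∨ b = 0)
    (hore : ∀ a b : MonoidAlgebra ℤ Q, a ≠ 0 → b ≠ 0 →
      ∃ x y : MonoidAlgebra ℤ Q, x ≠ 0 ∧ y ≠ 0 ∧ a * x = b * y)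
    (S : Finset Q) :
    ∃ F : Finset Q, F.Nonempty ∧ (S * F).card < 2 * F.card := by
  by_contra hcon
  push Not at hcon
  have hpow : ∀ k : ℕ, ∀ F : Finset Q, F.Nonempty → 2 ^ k * F.card ≤ (S ^ k * F).card ∧
      (S ^ k * F).Nonempty := by
    intro k F hF
    have hpos := Finset.card_pos.2 hF
    induction k with
    | zero => simpa using hF
    | succ k ih =>
      have h1 := hcon _ ih.2
      rw [pow_succ' S, mul_assoc]
      have h2 : 2 ^ (k+1) * F.card ≤ (S * (S ^ k * F)).card := by
        rw [pow_succ', mul_assoc]; omega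
      exact ⟨h2, Finset.card_pos.1 (lt_of_lt_of_le (by positivity) h2)⟩
  -- choice of the exponent
  let r := S.card
  have hr : S.card ≤ 2 ^ r := Nat.lt_two_pow_self.le
  let D := 8 * (r + 1)
  let k := 2 * (2 * D)
  have hk : 8 * (r * k + 1) < 2 ^ k := by
    have a1 : 2 * D < 2 ^ (2 * D) := Nat.lt_two_pow_self
    have a2 : (2 : ℕ) ^ k = 2 ^ (2 * D) * 2 ^ (2 * D) := by rw [← pow_add]; congr 1; simp only [k]; ring
    rw [a2]
    have a3 : 8 * (r * k + 1) ≤ D * (k + 1) := by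
      simp only [D]; nlinarith [Nat.zero_le r, Nat.zero_le k]
    have a4 : D * (k + 1) ≤ (2 * D + 1) * (2 * D + 1) := by
      simp only [k]; nlinarith
    have a5 : D * (k + 1) < (2 * D + 1) * (2 * D + 1) := by
      simp only [k]; nlinarith
    calc _ ≤ _ := a3
      _ < _ := a5
      _ ≤ _ := Nat.mul_le_mul a1 a1
  obtain ⟨F, hF, hlt⟩ := expansion_bound hdom hore (S ^ k) (r * k)
    (Finset.card_pow_le.trans (by rw [pow_mul 2 r k]; exact Nat.pow_le_pow_left hr k)) (2 ^ k)
    (by exact_mod_cast hk)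
  have := (hpow k F hF).1
  have h' : (S ^ k * F).card < 2 ^ k * F.card := by exact_mod_cast hlt
  omega

open scoped Pointwise in
lemma groupRing_ore_aux
    (G : Type) [Group G] (N : Subgroup G) [N.Normal]
    (hNdom : ∀ a b : MonoidAlgebra ℤ N, a * b = 0 → a = 0 ∨ b = 0)
    (hNore : ∀ a b : MonoidAlgebra ℤ N, a ≠ 0 → b ≠ 0 →
      ∃ x y : MonoidAlgebra ℤ N, x ≠ 0 ∧ y ≠ 0 ∧ a * x = b * y)
    (hQdom : ∀ a b : MonoidAlgebra ℤ (G ⧸ N), a * b = 0 → a = 0 ∨ b = 0)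
    (hQore : ∀ a b : MonoidAlgebra ℤ (G ⧸ N), a ≠ 0 → b ≠ 0 →
      ∃ x y : MonoidAlgebra ℤ (G ⧸ N), x ≠ 0 ∧ y ≠ 0 ∧ a * x = b * y)
    (hGdom : ∀ a b : MonoidAlgebra ℤ G, a * b = 0 → a = 0 ∨ b = 0) :
    ∀ a b : MonoidAlgebra ℤ G, a ≠ 0 → b ≠ 0 →
      ∃ x y : MonoidAlgebra ℤ G, x ≠ 0 ∧ y ≠ 0 ∧ a * x = b * y := by
  classical
  intro a b ha hb
  let σ : G ⧸ N → G := Quotient.out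
  have hσ : ∀ q, ((σ q : G) : G ⧸ N) = q := fun q => Quotient.out_eq' q
  let S : Finset (G ⧸ N) := (a.coeff.support ∪ b.coeff.support).image (fun g : G => (g : G ⧸ N))
  obtain ⟨F, -, hF⟩ := ore_folner hQdom hQore S
  -- components
  have hinj : ∀ g : G, Function.Injective (fun n : N => g * (n : G)) :=
    fun g n m h => Subtype.ext (mul_left_cancel h)
  let κ : G ⧸ N → MonoidAlgebra ℤ G →+ MonoidAlgebra ℤ N :=
    fun q => MonoidAlgebra.comapDomainAddMonoidHom (fun n : N => σ q * (n : G)) (hinj _)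
  have hκ : ∀ q c (n : N), (κ q c).coeff n = c.coeff (σ q * n) := by
    intro q c n
    simp [κ]
  let ι : MonoidAlgebra ℤ N →+* MonoidAlgebra ℤ G := MonoidAlgebra.mapDomainRingHom ℤ N.subtype
  have hκmul : ∀ q c x, κ q (c * ι x) = κ q c * x := by
    intro q c x
    induction x using MonoidAlgebra.induction_linear with
    | zero => simp
    | add f g hf hg => rw [map_add, mul_add, map_add, hf, hg, mul_add]
    | single m r =>
      ext n
      rw [hκ]
      simp [ι, MonoidAlgebra.coeff_mul_single_apply, hκ, mul_assoc]
  have hκinj : ∀ c, (∀ q, κ q c = 0) → c = 0 := by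
    intro c hc
    ext g
    have hmem : (σ (g : G ⧸ N))⁻¹ * g ∈ N := by
      rw [← QuotientGroup.eq]; exact hσ _
    have := hκ (g : G ⧸ N) c ⟨_, hmem⟩
    rw [hc] at this
    simpa using this.symm
  have hκsupp : ∀ c : MonoidAlgebra ℤ G, c.coeff.support ⊆ a.coeff.support ∪ b.coeff.support →
      ∀ f ∈ F, ∀ q, q ∉ S * F → κ q (c * MonoidAlgebra.single (σ f) 1) = 0 := by
    intro c hc f hf q hq
    ext n
    rw [hκ, MonoidAlgebra.coeff_mul_single_apply]
    simp only [mul_one, MonoidAlgebra.coeff_zero, Finsupp.zero_apply]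
    by_contra hne
    apply hq
    have h1 : (σ q * n * (σ f)⁻¹) ∈ a.coeff.support ∪ b.coeff.support :=
      hc (Finsupp.mem_support_iff.2 hne)
    have h2 := Finset.mul_mem_mul (Finset.mem_image_of_mem (fun g : G => (g : G ⧸ N)) h1) hf
    have h3 : ((σ q * n * (σ f)⁻¹ : G) : G ⧸ N) * f = q := by
      rw [QuotientGroup.mk_mul, QuotientGroup.mk_mul, QuotientGroup.mk_inv, hσ, hσ,
        (QuotientGroup.eq_one_iff (n : G)).2 n.2]
      simp
    rwa [h3] at h2
  -- the linear system over the group ring of N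
  let cf : Bool → MonoidAlgebra ℤ G := fun i => if i then a else -b
  have hcf : ∀ i, (cf i).coeff.support ⊆ a.coeff.support ∪ b.coeff.support := by
    intro i
    cases i
    · simp [cf]
    · simp [cf]
  obtain ⟨z, ⟨j0, hj0, hz0⟩, hsol⟩ := ore_system hNdom hNore (S * F)
    ((Finset.univ : Finset Bool) ×ˢ F)
    (fun q p => κ q (cf p.1 * MonoidAlgebra.single (σ p.2) 1)) (by
      rw [Finset.card_product]; simpa using hF)
  let X : Bool → MonoidAlgebra ℤ G := fun i => ∑ f ∈ F, MonoidAlgebra.single (σ f) 1 * ι (z (i, f))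
  have hXcomp : ∀ i, ∀ f ∈ F, κ f (X i) = z (i, f) := by
    intro i f hf
    simp only [X, map_sum, hκmul]
    rw [Finset.sum_eq_single f]
    · have : κ f (MonoidAlgebra.single (σ f) 1) = 1 := by
        ext n
        rw [hκ, MonoidAlgebra.one_def, MonoidAlgebra.coeff_single, MonoidAlgebra.coeff_single,
          Finsupp.single_apply, Finsupp.single_apply]
        simp [eq_comm]
      rw [this, one_mul]
    · intro f' _ hne
      have : κ f (MonoidAlgebra.single (σ f') 1) = 0 := by
        ext n
        rw [hκ, MonoidAlgebra.coeff_single, Finsupp.single_apply, if_neg]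
        · rfl
        · intro h
          apply hne
          rw [← hσ f', h, QuotientGroup.mk_mul, hσ, (QuotientGroup.eq_one_iff (n : G)).2 n.2, mul_one]
      rw [this, zero_mul]
    · exact fun h => absurd hf h
  have hsum : a * X true - b * X false = 0 := by
    apply hκinj
    intro q
    have e : a * X true - b * X false = ∑ p ∈ (Finset.univ : Finset Bool) ×ˢ F,
        cf p.1 * MonoidAlgebra.single (σ p.2) 1 * ι (z p) := by
      rw [Finset.sum_product]
      simp only [Fintype.sum_bool, cf, X, Finset.mul_sum, if_true, mul_assoc]
      simp [sub_eq_add_neg]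
    rw [e, map_sum]
    simp only [hκmul]
    by_cases hq : q ∈ S * F
    · exact hsol q hq
    · refine Finset.sum_eq_zero fun p hp => ?_
      rw [hκsupp _ (hcf _) _ (Finset.mem_product.1 hp).2 q hq, zero_mul]
  have hab : a * X true = b * X false := sub_eq_zero.1 hsum
  have hnz : X j0.1 ≠ 0 := by
    intro h
    apply hz0
    have := hXcomp j0.1 j0.2 (Finset.mem_product.1 hj0).2
    rw [h, map_zero] at this
    exact this.symm
  refine ⟨X true, X false, ?_, ?_, hab⟩
  · intro h
    rw [h, mul_zero] at hab
    rcases hGdom _ _ hab.symm with h' | h'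
    · exact hb h'
    · rcases j0 with ⟨_ | _, f⟩
      · exact hnz h'
      · exact hnz h
  · intro h
    rw [h, mul_zero] at hab
    rcases hGdom _ _ hab with h' | h'
    · exact ha h'
    · rcases j0 with ⟨_ | _, f⟩
      · exact hnz h
      · exact hnz h'

/-- The class of groups whose integral group ring satisfies the right
Ore condition is closed under extensions: if `N ◁ G`, `ℤ[N]` and `ℤ[G/N]` are right
Ore domains, and `ℤ[G]` is a domain, then `ℤ[G]` is a right Ore domain (i.e. satisfies
the right Ore condition: any two nonzero elements have a common nonzero right multiple). -/
theorem groupRing_ore_closed_under_extension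
    (G : Type) [Group G] (N : Subgroup G) [N.Normal]
    (hNdom : ∀ a b : MonoidAlgebra ℤ N, a * b = 0 → a = 0 ∨ b = 0)
    (hNore : ∀ a b : MonoidAlgebra ℤ N, a ≠ 0 → b ≠ 0 →
      ∃ x y : MonoidAlgebra ℤ N, x ≠ 0 ∧ y ≠ 0 ∧ a * x = b * y)
    (hQdom : ∀ a b : MonoidAlgebra ℤ (G ⧸ N), a * b = 0 → a = 0 ∨ b = 0)
    (hQore : ∀ a b : MonoidAlgebra ℤ (G ⧸ N), a ≠ 0 → b ≠ 0 →
      ∃ x y : MonoidAlgebra ℤ (G ⧸ N), x ≠ 0 ∧ y ≠ 0 ∧ a * x = b * y)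
    (hGdom : ∀ a b : MonoidAlgebra ℤ G, a * b = 0 → a = 0 ∨ b = 0) :
    ∀ a b : MonoidAlgebra ℤ G, a ≠ 0 → b ≠ 0 →
      ∃ x y : MonoidAlgebra ℤ G, x ≠ 0 ∧ y ≠ 0 ∧ a * x = b * y := by
  exact groupRing_ore_aux G N hNdom hNore hQdom hQore hGdom
end

section
/- If φ: A → B is a surjective group homomorphism with ker φ ⊆ A^{(m)}_H, then φ induces isomorphisms A/A^{(n)}_H ≅ B/B^{(n)}_H for all n ≤ m. In particular, for every group G and every n, (G/G^{(n)}_H)^{(n)}_H is trivial. -/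
open scoped Classical

/-- The coefficient, at the coset `g N`, of the element of `ℤ[G/N]` represented by the
formal sum `∑ kᵢ·ηᵢ` encoded by the list `l` of pairs `(kᵢ, ηᵢ)`. -/
noncomputable def cosetCoeff {G : Type} [Group G] (N : Subgroup G)
    (l : List (ℤ × G)) (g : G) : ℤ :=
  (l.map fun p => if p.2⁻¹ * g ∈ N then p.1 else 0).sum

/-- The list `l` of pairs `(kᵢ, ηᵢ)` represents a nonzero element of `ℤ[G/N]`. -/
def NonzeroMod {G : Type} [Group G] (N : Subgroup G) (l : List (ℤ × G)) : Prop :=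
  ∃ g : G, cosetCoeff N l g ≠ 0

/-- The result of acting on the class of `x` in `N/[N,N]` by the element of `ℤ[G/N]`
represented by `l = [(k₁,η₁),…]`, computed in `G`:  `∏ ηᵢ⁻¹ x^{kᵢ} ηᵢ`. -/
def actList {G : Type} [Group G] (x : G) (l : List (ℤ × G)) : G :=
  (l.map fun p => p.2⁻¹ * x ^ p.1 * p.2).prod

/-- One step of the torsion-free derived series: the preimage in `N` of the
`ℤ[G/N]`-torsion submodule of `N/[N,N]` (wrapped with `Subgroup.closure`; since
`ℤ[G/N]` is an Ore domain the underlying set is already a subgroup). -/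
def tfStep {G : Type} [Group G] (N : Subgroup G) : Subgroup G :=
  Subgroup.closure
    { x | x ∈ N ∧ ∃ l : List (ℤ × G), NonzeroMod N l ∧ actList x l ∈ ⁅N, N⁆ }

/-- Harvey's torsion-free derived series `G⁽ⁿ⁾_H`. -/
def tfH (G : Type) [Group G] : ℕ → Subgroup G
  | 0 => ⊤
  | n + 1 => tfStep (tfH G n)

def FolnerGrp (Γ : Type) [Group Γ] : Prop :=
  ∀ (S : Finset Γ) (ε : ℝ), 0 < ε → ∃ F E : Finset Γ, F.Nonempty ∧
    (∀ s ∈ S, ∀ x ∈ F, s * x ∈ E) ∧ (E.card : ℝ) ≤ (1 + ε) * F.card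

theorem folner_comm (K : Type) [CommGroup K] : FolnerGrp K := by
  intro S ε hε
  let F : ℕ → Finset K := fun n =>
    (Fintype.piFinset (fun _ : S => Finset.range n)).image (fun f => ∏ s : S, (s : K) ^ (f s))
  have hcard : ∀ n, (F n).card ≤ n ^ S.card := by
    intro n
    refine Finset.card_image_le.trans ?_
    simp
  have hF1 : (F 1).Nonempty := by
    refine Finset.Nonempty.image ⟨fun _ => 0, by simp⟩ _
  have hmono : ∀ n, F n ⊆ F (n + 1) := by
    intro n
    refine Finset.image_subset_image ?_
    intro f
    simp only [Fintype.mem_piFinset, Finset.mem_range]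
    intro h s
    exact (h s).trans (Nat.lt_succ_self n)
  have hne : ∀ n, (F (n + 1)).Nonempty := by
    intro n
    induction n with
    | zero => exact hF1
    | succ n ih => exact ih.mono (hmono _)
  have hstep : ∀ n, ∀ s ∈ S, ∀ x ∈ F n, s * x ∈ F (n + 1) := by
    intro n s hs x hx
    simp only [F, Finset.mem_image, Fintype.mem_piFinset, Finset.mem_range] at hx ⊢
    obtain ⟨f, hf, rfl⟩ := hx
    refine ⟨fun t => f t + if t = ⟨s, hs⟩ then 1 else 0, ?_, ?_⟩
    · intro t
      have := hf t
      dsimp only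
      split_ifs <;> omega
    · simp only [pow_add, Finset.prod_mul_distrib, mul_comm s]
      congr 1
      simp [pow_ite, Finset.prod_ite_eq']
  by_contra hcon
  push Not at hcon
  have hgrow : ∀ n, (1 + ε) ^ n ≤ ((F (n + 1)).card : ℝ) := by
    intro n
    induction n with
    | zero =>
      have := hF1.card_pos
      simp only [pow_zero]
      exact_mod_cast this
    | succ n ih =>
      have h := hcon (F (n + 1)) (F (n + 1 + 1)) (hne n) (hstep _)
      rw [pow_succ']
      exact (mul_le_mul_of_nonneg_left ih (by positivity)).trans h.le
  have ht := tendsto_pow_const_div_const_pow_of_one_lt S.card (r := 1 + ε) (by linarith)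
  have hev := ht.eventually (gt_mem_nhds (show (0 : ℝ) < 1 / (1 + ε) by positivity))
  obtain ⟨N, hN⟩ := Filter.eventually_atTop.1 hev
  have h1 := hN (N + 1) (by omega)
  have h2 := hgrow N
  have h3 : ((F (N + 1)).card : ℝ) ≤ ((N + 1 : ℕ) : ℝ) ^ S.card := by exact_mod_cast hcard (N + 1)
  have hp : (0 : ℝ) < (1 + ε) ^ N := by positivity
  rw [div_lt_div_iff₀ (by positivity) (by positivity), pow_succ] at h1
  have h4 := h2.trans h3
  nlinarith

theorem folner_ext {Γ Q : Type} [Group Γ] [Group Q] (f : Γ →* Q) (hf : Function.Surjective f)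
    (hK : FolnerGrp f.ker) (hQ : FolnerGrp Q) : FolnerGrp Γ := by
  intro S ε hε
  obtain ⟨δ, hδ, hδε⟩ : ∃ δ : ℝ, 0 < δ ∧ (1 + δ) * (1 + δ) ≤ 1 + ε := by
    refine ⟨min 1 (ε / 3), by positivity, ?_⟩
    have h1 := min_le_left 1 (ε / 3)
    have h2 := min_le_right 1 (ε / 3)
    have h3 : 0 < min 1 (ε / 3) := by positivity
    nlinarith
  obtain ⟨FQ, EQ, hFQ, hSQ, hcQ⟩ := hQ (S.image f) δ hδ
  obtain ⟨σ, hσ⟩ := hf.hasRightInverse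
  have hσ' : ∀ q, f (σ q) = q := hσ
  let κ : Γ → Q → f.ker := fun s t => ⟨(σ (f s * t))⁻¹ * (s * σ t), by
    simp [MonoidHom.mem_ker, hσ']⟩
  obtain ⟨FK, EK, hFK, hSK, hcK⟩ := hK ((S ×ˢ FQ).image fun p => κ p.1 p.2) δ hδ
  let j : Q × f.ker → Γ := fun p => σ p.1 * p.2
  have hj : Function.Injective j := by
    rintro ⟨q, k⟩ ⟨q', k'⟩ h
    have h1 : q = q' := by
      have := congrArg f h
      have hk := k.2
      have hk' := k'.2
      rw [MonoidHom.mem_ker] at hk hk'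
      simpa [j, hσ', hk, hk'] using this
    subst h1
    simpa [j] using h
  refine ⟨(FQ ×ˢ FK).image j, (EQ ×ˢ EK).image j, (hFQ.product hFK).image _, ?_, ?_⟩
  · intro s hs x hx
    simp only [Finset.mem_image, Finset.mem_product] at hx ⊢
    obtain ⟨⟨t, k⟩, ⟨ht, hk⟩, rfl⟩ := hx
    refine ⟨(f s * t, κ s t * k), ⟨hSQ _ (Finset.mem_image_of_mem _ hs) _ ht, hSK _ ?_ _ hk⟩, ?_⟩
    · exact Finset.mem_image.2 ⟨(s, t), Finset.mem_product.2 ⟨hs, ht⟩, rfl⟩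
    · simp [j, κ, mul_assoc]
  · rw [Finset.card_image_of_injective _ hj, Finset.card_image_of_injective _ hj,
      Finset.card_product, Finset.card_product]
    push_cast
    calc (EQ.card : ℝ) * EK.card ≤ ((1 + δ) * FQ.card) * ((1 + δ) * FK.card) := by gcongr
      _ = ((1 + δ) * (1 + δ)) * (FQ.card * FK.card) := by ring
      _ ≤ _ := by gcongr

theorem uniqueProds_comm (K : Type) [CommGroup K] (htf : ∀ (x : K) (k : ℕ), 0 < k → x ^ k = 1 → x = 1) :
    UniqueProds K := by
  constructor
  intro A B hA hB
  let H : Subgroup K := Subgroup.closure ((A : Set K) ∪ B)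
  have hfg : Group.FG H := by
    rw [Group.fg_iff_subgroup_fg]
    exact ⟨A ∪ B, by simp [H]⟩
  have : IsMulTorsionFree H := by
    constructor
    intro n hn x y hxy
    have h := htf ((x : K) / y) n (Nat.pos_of_ne_zero hn) (by
      rw [div_pow, div_eq_one]
      exact congrArg Subtype.val hxy)
    exact Subtype.ext (div_eq_one.1 h)
  have : UniqueProds H := inferInstance
  have hAH : ∀ a ∈ A, a ∈ H := fun a ha => Subgroup.subset_closure (Or.inl ha)
  have hBH : ∀ a ∈ B, a ∈ H := fun a ha => Subgroup.subset_closure (Or.inr ha)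
  obtain ⟨a, ha, b, hb, hu⟩ := this.uniqueMul_of_nonempty
    (A := A.subtype (· ∈ H)) (B := B.subtype (· ∈ H))
    (by obtain ⟨a, ha⟩ := hA; exact ⟨⟨a, hAH a ha⟩, by simpa using ha⟩)
    (by obtain ⟨a, ha⟩ := hB; exact ⟨⟨a, hBH a ha⟩, by simpa using ha⟩)
  refine ⟨a, by simpa using ha, b, by simpa using hb, ?_⟩
  intro x y hx hy hxy
  have := @hu ⟨x, hAH x hx⟩ ⟨y, hBH y hy⟩ (by simpa using hx) (by simpa using hy)
    (Subtype.ext hxy)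
  exact ⟨congrArg Subtype.val this.1, congrArg Subtype.val this.2⟩

theorem uniqueProds_ext {Γ Q : Type} [Group Γ] [Group Q] (f : Γ →* Q)
    (hK : UniqueProds f.ker) (hQ : UniqueProds Q) : UniqueProds Γ := by
  constructor
  intro A B hA hB
  obtain ⟨q, hq, q', hq', hu⟩ := hQ.uniqueMul_of_nonempty (hA.image f) (hB.image f)
  obtain ⟨g, hg, rfl⟩ := Finset.mem_image.1 hq
  obtain ⟨h, hh, rfl⟩ := Finset.mem_image.1 hq'
  obtain ⟨a, ha, b, hb, hu'⟩ := hK.uniqueMul_of_nonempty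
    (A := ((A.image fun a => g⁻¹ * a)).subtype (· ∈ f.ker))
    (B := ((B.image fun a => a * h⁻¹)).subtype (· ∈ f.ker))
    ⟨1, by simp [hg]⟩ ⟨1, by simp [hh]⟩
  have ha1 := a.2
  have hb1 := b.2
  rw [MonoidHom.mem_ker] at ha1 hb1
  simp only [Finset.mem_subtype, Finset.mem_image] at ha hb
  obtain ⟨a', ha', haa⟩ := ha
  obtain ⟨b', hb', hbb⟩ := hb
  rw [← haa] at ha1
  rw [← hbb] at hb1
  simp only [map_mul, map_inv, inv_mul_eq_one, mul_inv_eq_one] at ha1 hb1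
  refine ⟨a', ha', b', hb', UniqueMul.of_image_filter (f : Γ →ₙ* Q) rfl rfl ?_ ?_⟩
  · change UniqueMul (Finset.image f A) (Finset.image f B) (f a') (f b')
    rw [← ha1, hb1]; exact hu
  · intro x y hx hy hxy
    simp only [Finset.mem_filter] at hx hy
    have hx2 : f x = f a' := hx.2
    have hy2 : f y = f b' := hy.2
    have := @hu' ⟨g⁻¹ * x, by rw [MonoidHom.mem_ker]; simp [hx2, ha1]⟩
      ⟨y * h⁻¹, by rw [MonoidHom.mem_ker]; simp [hy2, hb1]⟩
      (by simpa using hx.1) (by simpa using hy.1)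
      (by
        apply Subtype.ext
        simp only [Subgroup.coe_mul, ← haa, ← hbb]
        calc g⁻¹ * x * (y * h⁻¹) = g⁻¹ * (x * y) * h⁻¹ := by group
          _ = _ := by rw [hxy]; group)
    have h1 := congrArg Subtype.val this.1
    have h2 := congrArg Subtype.val this.2
    simp only [← haa, ← hbb] at h1 h2
    exact ⟨mul_left_cancel h1, mul_right_cancel h2⟩

theorem ore_of_folner {Γ : Type} [Group Γ] (hU : UniqueProds Γ) (hF : FolnerGrp Γ)
    (r s : MonoidAlgebra ℤ Γ) (hr : r ≠ 0) (hs : s ≠ 0) :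
    ∃ u v : MonoidAlgebra ℤ Γ, r * u = s * v ∧ r * u ≠ 0 := by
  obtain ⟨F, E, hFne, hSE, hc⟩ := hF (r.coeff.support ∪ s.coeff.support) (1 / 2) (by norm_num)
  let ι : (F → ℤ) →ₗ[ℤ] MonoidAlgebra ℤ Γ :=
    Fintype.linearCombination ℤ (fun x : F => MonoidAlgebra.single (x : Γ) (1 : ℤ))
  have hι : ∀ u (y : F), (ι u).coeff y = u y := by
    intro u y
    simp [ι, Fintype.linearCombination_apply, Finsupp.single_apply, MonoidAlgebra.coeff_sum]
  have hι' : ∀ u (y : Γ), y ∉ F → (ι u).coeff y = 0 := by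
    intro u y hy
    simp only [ι, Fintype.linearCombination_apply, MonoidAlgebra.coeff_sum, Finsupp.finsetSum_apply]
    refine Finset.sum_eq_zero fun x _ => ?_
    have : (x : Γ) ≠ y := fun h => hy (h ▸ x.2)
    simp [this]
  have hout : ∀ t : MonoidAlgebra ℤ Γ, t.coeff.support ⊆ r.coeff.support ∪ s.coeff.support →
      ∀ u (y : Γ), y ∉ E → (t * ι u).coeff y = 0 := by
    intro t ht u y hy
    by_contra hne
    have := MonoidAlgebra.support_coeff_mul_subset t (ι u) (Finsupp.mem_support_iff.2 hne)
    obtain ⟨a, ha, b, hb, rfl⟩ := Finset.mem_mul.1 this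
    refine hy (hSE a (ht ha) b ?_)
    by_contra hbF
    exact (Finsupp.mem_support_iff.1 hb) (hι' u b hbF)
  let D : ((F → ℤ) × (F → ℤ)) →ₗ[ℤ] MonoidAlgebra ℤ Γ :=
    ((LinearMap.mulLeft ℤ r).comp ι).comp (LinearMap.fst ℤ _ _) -
    ((LinearMap.mulLeft ℤ s).comp ι).comp (LinearMap.snd ℤ _ _)
  have hD : ∀ p, D p = r * ι p.1 - s * ι p.2 := fun p => rfl
  let L : ((F → ℤ) × (F → ℤ)) →ₗ[ℤ] (E → ℤ) :=
    { toFun := fun p e => (D p).coeff e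
      map_add' := by intro p q; ext e; simp
      map_smul' := by intro c p; ext e; rw [map_smul]; rfl }
  have hninj : ¬ Function.Injective L := by
    intro hinj
    have := LinearMap.finrank_le_finrank_of_injective hinj
    simp only [Module.finrank_prod, Module.finrank_fintype_fun_eq_card, Fintype.card_coe] at this
    have h1 : (F.card : ℝ) + F.card ≤ E.card := by exact_mod_cast this
    have h2 : (0 : ℝ) < F.card := by exact_mod_cast hFne.card_pos
    linarith
  have hex : ∃ p, L p = 0 ∧ p ≠ 0 := by
    by_contra hcon
    push Not at hcon
    exact hninj ((injective_iff_map_eq_zero L).2 hcon)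
  obtain ⟨p, hp0, hpne⟩ := hex
  have hDp : r * ι p.1 = s * ι p.2 := by
    rw [← sub_eq_zero, ← hD]
    ext y
    by_cases hy : y ∈ E
    · exact congrFun hp0 ⟨y, hy⟩
    · rw [hD, MonoidAlgebra.coeff_sub, Finsupp.sub_apply, hout r Finset.subset_union_left _ _ hy,
        hout s Finset.subset_union_right _ _ hy]
      simp
  have hι0 : ∀ u, ι u = 0 → u = 0 := by
    intro u hu
    ext y
    have := hι u y
    rw [hu] at this
    simpa using this.symm
  refine ⟨ι p.1, ι p.2, hDp, ?_⟩
  intro h0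
  apply hpne
  have h1 := hι0 _ ((mul_eq_zero.1 h0).resolve_left hr)
  have h2 := hι0 _ ((mul_eq_zero.1 (hDp ▸ h0)).resolve_left hs)
  exact Prod.ext h1 h2

noncomputable def toAlg {G : Type} [Group G] (N : Subgroup G) [N.Normal] (l : List (ℤ × G)) :
    MonoidAlgebra ℤ (G ⧸ N) :=
  (l.map fun p => MonoidAlgebra.single (p.2 : G ⧸ N) p.1).sum

theorem toAlg_coeff {G : Type} [Group G] (N : Subgroup G) [N.Normal] (l : List (ℤ × G)) (g : G) :
    (toAlg N l).coeff (g : G ⧸ N) = cosetCoeff N l g := by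
  induction l with
  | nil => simp [toAlg, cosetCoeff]
  | cons p l ih =>
    simp only [toAlg, cosetCoeff, List.map_cons, List.sum_cons] at ih ⊢
    rw [MonoidAlgebra.coeff_add, Finsupp.add_apply, ih, MonoidAlgebra.coeff_single,
      Finsupp.single_apply]
    simp only [QuotientGroup.eq]

theorem nonzeroMod_iff {G : Type} [Group G] (N : Subgroup G) [N.Normal] (l : List (ℤ × G)) :
    NonzeroMod N l ↔ toAlg N l ≠ 0 := by
  constructor
  · rintro ⟨g, hg⟩ h
    rw [← toAlg_coeff, h] at hg
    simp at hg
  · intro h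
    by_contra hcon
    apply h
    ext q
    obtain ⟨g, rfl⟩ := QuotientGroup.mk_surjective q
    rw [toAlg_coeff]
    by_contra hne
    exact hcon ⟨g, hne⟩

theorem toAlg_surj {G : Type} [Group G] (N : Subgroup G) [N.Normal]
    (r : MonoidAlgebra ℤ (G ⧸ N)) : ∃ l, toAlg N l = r := by
  induction r using MonoidAlgebra.induction_linear with
  | zero => exact ⟨[], by simp [toAlg]⟩
  | add x y hx hy =>
    obtain ⟨l, rfl⟩ := hx
    obtain ⟨l', rfl⟩ := hy
    exact ⟨l ++ l', by simp [toAlg]⟩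
  | single q k =>
    obtain ⟨g, rfl⟩ := QuotientGroup.mk_surjective q
    exact ⟨[(k, g)], by simp [toAlg]⟩

/-- The abelian group `N/[N,N]`, written additively. -/
abbrev AbN {G : Type} [Group G] (N : Subgroup G) : Type := Additive (Abelianization N)

noncomputable def cl {G : Type} [Group G] (N : Subgroup G) (x : N) : AbN N :=
  Additive.ofMul (Abelianization.of x)

theorem cl_surj {G : Type} [Group G] (N : Subgroup G) (m : AbN N) : ∃ x, cl N x = m :=
  QuotientGroup.mk_surjective m

theorem cl_mul {G : Type} [Group G] (N : Subgroup G) (x y : N) :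
    cl N (x * y) = cl N x + cl N y := by
  simp [cl]

theorem cl_zpow {G : Type} [Group G] (N : Subgroup G) (x : N) (k : ℤ) :
    cl N (x ^ k) = k • cl N x := by
  simp [cl]

theorem cl_eq_zero {G : Type} [Group G] (N : Subgroup G) (x : N) :
    cl N x = 0 ↔ (x : G) ∈ ⁅N, N⁆ := by
  rw [← Subgroup.map_subtype_commutator]
  have h : cl N x = 0 ↔ x ∈ commutator N := by
    exact QuotientGroup.eq_one_iff x
  rw [h]
  simp

noncomputable def conjEnd {G : Type} [Group G] (N : Subgroup G) [N.Normal] (g : G) :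
    AddMonoid.End (AbN N) :=
  MonoidHom.toAdditive (Abelianization.map (MulAut.conjNormal g⁻¹ : MulAut N).toMonoidHom)

theorem conjEnd_cl {G : Type} [Group G] (N : Subgroup G) [N.Normal] (g : G) (x : N) :
    conjEnd N g (cl N x) = cl N (MulAut.conjNormal g⁻¹ x) := rfl

noncomputable def conjHom {G : Type} [Group G] (N : Subgroup G) [N.Normal] :
    G →* (AddMonoid.End (AbN N))ᵐᵒᵖ where
  toFun g := MulOpposite.op (conjEnd N g)
  map_one' := by
    apply MulOpposite.unop_injective
    ext m
    obtain ⟨x, rfl⟩ := cl_surj N m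
    simp [conjEnd_cl]
  map_mul' g h := by
    apply MulOpposite.unop_injective
    ext m
    obtain ⟨x, rfl⟩ := cl_surj N m
    simp [conjEnd_cl]

noncomputable def rhoQ {G : Type} [Group G] (N : Subgroup G) [N.Normal] :
    (G ⧸ N) →* (AddMonoid.End (AbN N))ᵐᵒᵖ :=
  QuotientGroup.lift N (conjHom N) (by
    intro n hn
    apply MulOpposite.unop_injective
    ext m
    obtain ⟨x, rfl⟩ := cl_surj N m
    change conjEnd N n (cl N x) = cl N x
    rw [conjEnd_cl]
    have : (MulAut.conjNormal n⁻¹ x : N) = (⟨n, hn⟩ : N)⁻¹ * x * ⟨n, hn⟩ := by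
      apply Subtype.ext
      simp
    rw [this, cl_mul, cl_mul, add_right_comm, ← cl_mul]
    simp [cl])

noncomputable def rho {G : Type} [Group G] (N : Subgroup G) [N.Normal] :
    MonoidAlgebra ℤ (G ⧸ N) →ₐ[ℤ] (AddMonoid.End (AbN N))ᵐᵒᵖ :=
  MonoidAlgebra.lift ℤ (AddMonoid.End (AbN N))ᵐᵒᵖ (G ⧸ N) (rhoQ N)

/-- right action of the group ring -/
noncomputable def act {G : Type} [Group G] (N : Subgroup G) [N.Normal]
    (m : AbN N) (r : MonoidAlgebra ℤ (G ⧸ N)) : AbN N := (rho N r).unop m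

section
variable {G : Type} [Group G] (N : Subgroup G) [N.Normal]

theorem act_mul (m : AbN N) (r s : MonoidAlgebra ℤ (G ⧸ N)) :
    act N m (r * s) = act N (act N m r) s := by
  simp [act]

theorem act_add (m : AbN N) (r s : MonoidAlgebra ℤ (G ⧸ N)) :
    act N m (r + s) = act N m r + act N m s := by
  simp only [act, map_add, MulOpposite.unop_add]
  rfl

theorem act_add_left (m m' : AbN N) (r : MonoidAlgebra ℤ (G ⧸ N)) :
    act N (m + m') r = act N m r + act N m' r := by
  simp [act]

theorem act_zero_left (r : MonoidAlgebra ℤ (G ⧸ N)) : act N 0 r = 0 := by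
  simp [act]

theorem act_neg_left (m : AbN N) (r : MonoidAlgebra ℤ (G ⧸ N)) :
    act N (-m) r = - act N m r := by
  simp [act]

theorem act_zero (m : AbN N) : act N m 0 = 0 := by
  simp [act]

theorem act_single (x : N) (g : G) (k : ℤ) :
    act N (cl N x) (MonoidAlgebra.single (g : G ⧸ N) k) =
      cl N (MulAut.conjNormal g⁻¹ (x ^ k)) := by
  rw [← conjEnd_cl, cl_zpow, map_zsmul]
  simp [act, rho, MonoidAlgebra.lift_single]
  rfl

theorem actList_spec (x : N) (l : List (ℤ × G)) :
    ∃ y : N, (y : G) = actList (x : G) l ∧ cl N y = act N (cl N x) (toAlg N l) := by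
  induction l with
  | nil => exact ⟨1, by simp [actList], by simp [toAlg, act_zero, cl]⟩
  | cons p l ih =>
    obtain ⟨y, hy, hy'⟩ := ih
    refine ⟨MulAut.conjNormal p.2⁻¹ (x ^ p.1) * y, ?_, ?_⟩
    · have := conj_zpow (a := p.2⁻¹) (b := (x : G)) (i := p.1)
      rw [inv_inv] at this
      simp [actList, hy, this]
    · rw [cl_mul, hy', ← act_single, ← act_add]
      simp [toAlg]

theorem torsion_iff (x : N) :
    (∃ l : List (ℤ × G), NonzeroMod N l ∧ actList (x : G) l ∈ ⁅N, N⁆) ↔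
      ∃ r, r ≠ 0 ∧ act N (cl N x) r = 0 := by
  constructor
  · rintro ⟨l, hl, h⟩
    obtain ⟨y, hy, hy'⟩ := actList_spec N x l
    refine ⟨toAlg N l, (nonzeroMod_iff N l).1 hl, ?_⟩
    rw [← hy', cl_eq_zero, hy]
    exact h
  · rintro ⟨r, hr, h⟩
    obtain ⟨l, rfl⟩ := toAlg_surj N r
    obtain ⟨y, hy, hy'⟩ := actList_spec N x l
    refine ⟨l, (nonzeroMod_iff N l).2 hr, ?_⟩
    rw [← hy, ← cl_eq_zero, hy', h]

/-- The quotient has Ore-domain group ring, by way of unique products and Følner sets. -/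
def GoodGrp (Γ : Type) [Group Γ] : Prop := UniqueProds Γ ∧ FolnerGrp Γ

theorem mem_tfStep (hG : GoodGrp (G ⧸ N)) (x : G) :
    x ∈ tfStep N ↔ ∃ hx : x ∈ N, ∃ r, r ≠ 0 ∧ act N (cl N ⟨x, hx⟩) r = 0 := by
  have := hG.1
  constructor
  · intro h
    induction h using Subgroup.closure_induction with
    | mem x hx =>
      obtain ⟨hx, h⟩ := hx
      exact ⟨hx, (torsion_iff N ⟨x, hx⟩).1 h⟩
    | one =>
      refine ⟨N.one_mem, 1, one_ne_zero, ?_⟩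
      have : cl N ⟨1, N.one_mem⟩ = 0 := (cl_eq_zero N _).2 (Subgroup.one_mem _)
      rw [this, act_zero_left]
    | mul x y _ _ hx hy =>
      obtain ⟨hx, r, hr, hxr⟩ := hx
      obtain ⟨hy, s, hs, hys⟩ := hy
      obtain ⟨u, v, huv, hne⟩ := ore_of_folner hG.1 hG.2 r s hr hs
      refine ⟨N.mul_mem hx hy, r * u, hne, ?_⟩
      have : cl N ⟨x * y, N.mul_mem hx hy⟩ = cl N ⟨x, hx⟩ + cl N ⟨y, hy⟩ :=
        cl_mul N ⟨x, hx⟩ ⟨y, hy⟩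
      rw [this, act_add_left, act_mul, hxr, huv, act_mul, hys, act_zero_left, act_zero_left,
        add_zero]
    | inv x _ hx =>
      obtain ⟨hx, r, hr, hxr⟩ := hx
      refine ⟨N.inv_mem hx, r, hr, ?_⟩
      have : cl N ⟨x⁻¹, N.inv_mem hx⟩ = - cl N ⟨x, hx⟩ := by
        rw [eq_neg_iff_add_eq_zero, ← cl_mul, cl_eq_zero]
        simp
      rw [this, act_neg_left, hxr, neg_zero]
  · rintro ⟨hx, h⟩
    exact Subgroup.subset_closure ⟨hx, (torsion_iff N ⟨x, hx⟩).2 h⟩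

theorem tfStep_le {G : Type} [Group G] (N : Subgroup G) : tfStep N ≤ N :=
  (Subgroup.closure_le _).2 fun _ hx => hx.1

theorem commutator_le_tfStep {G : Type} [Group G] (N : Subgroup G) [N.Normal] :
    ⁅N, N⁆ ≤ tfStep N := by
  intro x hx
  have hN : x ∈ N := Subgroup.commutator_le_self N hx
  refine Subgroup.subset_closure ⟨hN, [(1, 1)], ⟨1, ?_⟩, ?_⟩
  · simp [cosetCoeff, N.one_mem]
  · simpa [actList] using hx

theorem tfStep_normal : (tfStep N).Normal := by
  constructor
  intro x hx g
  induction hx using Subgroup.closure_induction with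
  | mem x hx =>
    obtain ⟨hx, l, ⟨h, hl⟩, hxl⟩ := hx
    refine Subgroup.subset_closure ⟨Subgroup.Normal.conj_mem inferInstance x hx g,
      l.map fun p => (p.1, g * p.2), ⟨g * h, ?_⟩, ?_⟩
    · convert hl using 1
      simp [cosetCoeff, Function.comp_def, mul_assoc]
    · convert hxl using 1
      simp only [actList, List.map_map, Function.comp_def, conj_zpow]
      simp [mul_assoc]
  | one => simp
  | mul x y _ _ hx hy =>
    have := Subgroup.mul_mem _ hx hy
    simpa [mul_assoc] using this
  | inv x _ hx =>
    have := Subgroup.inv_mem _ hx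
    simpa [mul_assoc] using this

/-- `N / tfStep N` is torsion free. -/
theorem tfStep_torsionfree (hG : GoodGrp (G ⧸ N)) (a : G) (ha : a ∈ N) (l : List (ℤ × G))
    (hl : NonzeroMod N l) (h : actList a l ∈ tfStep N) : a ∈ tfStep N := by
  have := hG.1
  obtain ⟨y, hy, hy'⟩ := actList_spec N ⟨a, ha⟩ l
  obtain ⟨hyN, r, hr, hyr⟩ := (mem_tfStep N hG _).1 h
  refine (mem_tfStep N hG a).2 ⟨ha, toAlg N l * r, mul_ne_zero ((nonzeroMod_iff N l).1 hl) hr, ?_⟩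
  have : y = ⟨actList a l, hyN⟩ := Subtype.ext hy
  rw [act_mul, ← hy', this, hyr]

end

theorem good_of_subsingleton (Γ : Type) [Group Γ] [Subsingleton Γ] : GoodGrp Γ := by
  refine ⟨⟨?_⟩, ?_⟩
  · rintro A B ⟨a, ha⟩ ⟨b, hb⟩
    exact ⟨a, ha, b, hb, UniqueMul.of_subsingleton⟩
  · intro S ε hε
    refine ⟨{1}, {1}, by simp, ?_, ?_⟩
    · intro s _ x _
      exact Finset.mem_singleton.2 (Subsingleton.elim _ _)
    · simp [hε.le]

theorem good_ext {Γ Q : Type} [Group Γ] [Group Q] (f : Γ →* Q) (hf : Function.Surjective f)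
    (hQ : GoodGrp Q) (hcomm : ∀ x ∈ f.ker, ∀ y ∈ f.ker, x * y = y * x)
    (htf : ∀ x ∈ f.ker, ∀ k : ℕ, 0 < k → x ^ k = 1 → x = 1) : GoodGrp Γ := by
  let inst : CommGroup f.ker :=
    { (inferInstance : Group f.ker) with
      mul_comm := fun x y => Subtype.ext (hcomm x x.2 y y.2) }
  refine ⟨uniqueProds_ext f (@uniqueProds_comm f.ker inst ?_) hQ.1,
    folner_ext f hf (@folner_comm f.ker inst) hQ.2⟩
  intro x k hk hx
  exact Subtype.ext (htf x x.2 k hk (congrArg Subtype.val hx))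

theorem good_step {G : Type} [Group G] (N : Subgroup G) [N.Normal] [(tfStep N).Normal]
    (hG : GoodGrp (G ⧸ N)) : GoodGrp (G ⧸ tfStep N) := by
  let f : G ⧸ tfStep N →* G ⧸ N := QuotientGroup.map (tfStep N) N (MonoidHom.id G) (tfStep_le N)
  have hker : ∀ x : G, (x : G ⧸ tfStep N) ∈ f.ker → x ∈ N := by
    intro x hx
    exact (QuotientGroup.eq_one_iff x).1 hx
  refine good_ext f ?_ hG ?_ ?_
  · intro q
    obtain ⟨g, rfl⟩ := QuotientGroup.mk_surjective q
    exact ⟨(g : G ⧸ tfStep N), rfl⟩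
  · intro x hx y hy
    obtain ⟨x, rfl⟩ := QuotientGroup.mk_surjective x
    obtain ⟨y, rfl⟩ := QuotientGroup.mk_surjective y
    rw [← QuotientGroup.mk_mul, ← QuotientGroup.mk_mul, QuotientGroup.eq]
    apply commutator_le_tfStep N
    have := Subgroup.commutator_mem_commutator (N.inv_mem (hker _ hy)) (N.inv_mem (hker _ hx))
    rw [commutatorElement_def] at this
    simpa [mul_assoc] using this
  · intro x hx k hk h
    obtain ⟨x, rfl⟩ := QuotientGroup.mk_surjective x
    rw [← QuotientGroup.mk_pow, QuotientGroup.eq_one_iff] at h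
    rw [QuotientGroup.eq_one_iff]
    refine tfStep_torsionfree N hG x (hker _ hx) [((k : ℤ), 1)] ⟨1, ?_⟩ ?_
    · simp [cosetCoeff, N.one_mem, hk.ne']
    · simpa [actList] using h

theorem tfH_good (G : Type) [Group G] (n : ℕ) :
    ∃ _h : (tfH G n).Normal, GoodGrp (G ⧸ tfH G n) := by
  induction n with
  | zero =>
    have hn : (tfH G 0).Normal := inferInstanceAs (⊤ : Subgroup G).Normal
    refine ⟨hn, ?_⟩
    have : Subsingleton (G ⧸ tfH G 0) := QuotientGroup.subsingleton_quotient_top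
    exact good_of_subsingleton _
  | succ n ih =>
    obtain ⟨h, hg⟩ := ih
    have h' : (tfStep (tfH G n)).Normal := tfStep_normal _
    exact ⟨h', good_step (tfH G n) hg⟩

theorem tfH_antitone (G : Type) [Group G] : Antitone (tfH G) :=
  antitone_nat_of_succ_le fun n => tfStep_le (tfH G n)

theorem tfStep_map_iff {A B : Type} [Group A] [Group B] (φ : A →* B)
    (hφ : Function.Surjective φ) (N : Subgroup A) (M : Subgroup B) [N.Normal]
    (hNM : ∀ a, a ∈ N ↔ φ a ∈ M) (hG : GoodGrp (A ⧸ N)) (hker : φ.ker ≤ tfStep N) (a : A) :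
    a ∈ tfStep N ↔ φ a ∈ tfStep M := by
  have hcoeff : ∀ (l : List (ℤ × A)) (g : A),
      cosetCoeff M (l.map fun p => (p.1, φ p.2)) (φ g) = cosetCoeff N l g := by
    intro l g
    simp [cosetCoeff, Function.comp_def, hNM]
  have hact : ∀ (x : A) (l : List (ℤ × A)),
      actList (φ x) (l.map fun p => (p.1, φ p.2)) = φ (actList x l) := by
    intro x l
    simp [actList, Function.comp_def, map_list_prod]
  have hmap : N.map φ = M := by
    ext b
    obtain ⟨a, rfl⟩ := hφ b
    constructor
    · rintro ⟨a', ha', h⟩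
      rw [← h]
      exact (hNM a').1 ha'
    · intro h
      exact ⟨a, (hNM a).2 h, rfl⟩
  have hcomm : (⁅N, N⁆ : Subgroup A).map φ = ⁅M, M⁆ := by
    rw [Subgroup.map_commutator, hmap]
  constructor
  · intro h
    have hle : tfStep N ≤ (tfStep M).comap φ := by
      refine (Subgroup.closure_le _).2 ?_
      rintro x ⟨hx, l, ⟨g, hg⟩, hl⟩
      refine Subgroup.subset_closure ⟨(hNM x).1 hx, l.map fun p => (p.1, φ p.2), ⟨φ g, ?_⟩, ?_⟩
      · rw [hcoeff]
        exact hg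
      · rw [hact, ← hcomm]
        exact Subgroup.mem_map_of_mem φ hl
    exact hle h
  · intro h
    have hle : tfStep M ≤ (tfStep N).map φ := by
      refine (Subgroup.closure_le _).2 ?_
      rintro y ⟨hy, l', ⟨g', hg⟩, hl⟩
      obtain ⟨x, rfl⟩ := hφ y
      obtain ⟨g, rfl⟩ := hφ g'
      obtain ⟨l, rfl⟩ : ∃ l : List (ℤ × A), (l.map fun p => (p.1, φ p.2)) = l' := by
        have hs : Function.Surjective (fun p : ℤ × A => (p.1, φ p.2)) := by
          rintro ⟨k, b⟩
          obtain ⟨a, rfl⟩ := hφ b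
          exact ⟨(k, a), rfl⟩
        exact List.map_surjective_iff.2 hs l'
      rw [hact, ← hcomm] at hl
      rw [hcoeff] at hg
      obtain ⟨c, hc, hcl⟩ := hl
      refine ⟨x, tfStep_torsionfree N hG x ((hNM x).2 hy) l ⟨g, hg⟩ ?_, rfl⟩
      have h1 : c⁻¹ * actList x l ∈ tfStep N := hker (by
        rw [MonoidHom.mem_ker, map_mul, map_inv, hcl, inv_mul_cancel])
      have := Subgroup.mul_mem _ (commutator_le_tfStep N hc) h1
      simpa using this
    obtain ⟨a', ha', h'⟩ := hle h
    have h1 : a'⁻¹ * a ∈ tfStep N := hker (by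
      rw [MonoidHom.mem_ker, map_mul, map_inv, h', inv_mul_cancel])
    have := Subgroup.mul_mem _ ha' h1
    simpa using this

theorem tfH_map_iff {A B : Type} [Group A] [Group B] (φ : A →* B)
    (hφ : Function.Surjective φ) (m : ℕ) (hker : φ.ker ≤ tfH A m) (n : ℕ) (hn : n ≤ m) :
    ∀ a : A, a ∈ tfH A n ↔ φ a ∈ tfH B n := by
  induction n with
  | zero => intro a; simp [tfH]
  | succ n ih =>
    obtain ⟨h, hg⟩ := tfH_good A n
    exact tfStep_map_iff φ hφ (tfH A n) (tfH B n) (ih (by omega)) hg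
      (hker.trans (tfH_antitone A hn))

/-- If `φ : A → B` is surjective with `ker φ ⊆ A⁽ᵐ⁾_H`, then `φ`
induces isomorphisms `A/A⁽ⁿ⁾_H ≅ B/B⁽ⁿ⁾_H` for all `n ≤ m` (by surjectivity this is
expressed by `a ∈ A⁽ⁿ⁾_H ↔ φ a ∈ B⁽ⁿ⁾_H`).  In particular `(G/G⁽ⁿ⁾_H)⁽ⁿ⁾_H` is
trivial for every group `G` and every `n`. -/
theorem tfH_quotient_iso :
    (∀ (A B : Type) [Group A] [Group B] (φ : A →* B), Function.Surjective φ →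
      ∀ m : ℕ, φ.ker ≤ tfH A m →
        ∀ n ≤ m, ∀ a : A, a ∈ tfH A n ↔ φ a ∈ tfH B n) ∧
    (∀ (G : Type) [Group G] (n : ℕ) [(tfH G n).Normal],
      tfH (G ⧸ tfH G n) n = ⊥) := by
  refine ⟨fun A B _ _ φ hφ m hker n hn a => tfH_map_iff φ hφ m hker n hn a, ?_⟩
  intro G _ n _
  rw [eq_bot_iff]
  intro q hq
  obtain ⟨g, rfl⟩ := QuotientGroup.mk'_surjective (tfH G n) q
  have := (tfH_map_iff (QuotientGroup.mk' (tfH G n)) (QuotientGroup.mk'_surjective _) n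
    (by rw [QuotientGroup.ker_mk']) n le_rfl g).2 hq
  exact Subgroup.mem_bot.2 ((QuotientGroup.eq_one_iff g).2 this)
end
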